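/- arXiv:1309.1420 — 2 statements merged into one kernel-verified Lean document; each statement's English description precedes it below -/
import Mathlib

section
/- Every f ∈ L⁰_𝒫(K_t + Λ_t; 𝓕_t) admits a decomposition f = g + h 𝒫-q.s. for some g ∈ L⁰(K_t;𝓕_t) and h ∈ L⁰(K̃_{t+1};𝓕_t). -/
open MeasureTheory Set
open scoped ENNReal Pointwise

noncomputable section

/-- The universal completion of the σ-algebra on `α`. -/
def univComp (α : Type*) [MeasurableSpace α] : MeasurableSpace α where
  MeasurableSet' s := ∀ μ : Measure α, IsProbabilityMeasure μ → NullMeasurableSet s μ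
  measurableSet_empty := fun _ _ => MeasurableSet.empty.nullMeasurableSet
  measurableSet_compl := fun _ hs μ hμ => (hs μ hμ).compl
  measurableSet_iUnion := fun _ hf μ hμ => NullMeasurableSet.iUnion fun i => hf i μ hμ

/-- A universally measurable set. -/
def UnivMeasurableSet {α : Type*} [MeasurableSpace α] (s : Set α) : Prop :=
  MeasurableSet[univComp α] s

/-- A universally measurable function. -/
def UnivMeasurable {α β : Type*} [MeasurableSpace α] [MeasurableSpace β] (f : α → β) : Prop :=
  Measurable[univComp α] f

/-- Convexity for a set of probability measures. -/
def ConvexProb {α : Type*} [MeasurableSpace α] (𝒬 : Set (ProbabilityMeasure α)) : Prop :=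
  ∀ P ∈ 𝒬, ∀ Q ∈ 𝒬, ∀ a b : ℝ≥0∞, a + b = 1 → ∀ R : ProbabilityMeasure α,
    (R : Measure α) = a • (P : Measure α) + b • (Q : Measure α) → R ∈ 𝒬

/-- The product measure `P₀ ⊗ ⋯ ⊗ P_{T-1}` of a family of one-step kernels. -/
def prodMeas {Ω₁ : Type*} [MeasurableSpace Ω₁]
    (P : (t : ℕ) → (Fin t → Ω₁) → Measure Ω₁) : (T : ℕ) → Measure (Fin T → Ω₁)
  | 0 => Measure.dirac (fun i => i.elim0)
  | T + 1 => (prodMeas P T).bind fun ω => (P T ω).map (Fin.snoc ω)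

/-- The set `𝒫` of all products of universally measurable selectors of the `𝒫ₜ`. -/
def ProdSet {Ω₁ : Type*} [MeasurableSpace Ω₁]
    (𝒬 : (t : ℕ) → (Fin t → Ω₁) → Set (ProbabilityMeasure Ω₁)) (T : ℕ) :
    Set (Measure (Fin T → Ω₁)) :=
  {μ | ∃ P : (t : ℕ) → (Fin t → Ω₁) → ProbabilityMeasure Ω₁,
      (∀ t, t < T → UnivMeasurable (fun ω => (P t ω : Measure Ω₁)) ∧ ∀ ω, P t ω ∈ 𝒬 t ω) ∧
      μ = prodMeas (fun t ω => (P t ω : Measure Ω₁)) T}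

/-- Projection onto the first `t` coordinates. -/
def proj {Ω₁ : Type*} (T t : ℕ) (ht : t ≤ T) (ω : Fin T → Ω₁) : Fin t → Ω₁ :=
  fun i => ω (Fin.castLE ht i)

/-- The σ-algebra `𝓕ₜ` on `Ω = Ω₁^T`: the pullback under the projection onto the first `t`
coordinates of the universal completion of the Borel σ-algebra of `Ω₁^t`. -/
def filt {Ω₁ : Type*} [MeasurableSpace Ω₁] (T t : ℕ) (ht : t ≤ T) :
    MeasurableSpace (Fin T → Ω₁) :=
  MeasurableSpace.comap (proj T t ht) (univComp (Fin t → Ω₁))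

/-- The dual cone of a set in `ℝ^d`. -/
def dualCone {d : ℕ} (C : Set (Fin d → ℝ)) : Set (Fin d → ℝ) :=
  {y | ∀ x ∈ C, 0 ≤ ∑ i, x i * y i}

/-- `Λ_t(ω)`: the vectors lying in `K̃_{t+1}(ω, ·) = (K̃*_{t+1}(ω, ·))*` `𝒫_t(ω)`-q.s. -/
def LambdaSet {Ω₁ : Type*} [MeasurableSpace Ω₁] {d : ℕ} {t : ℕ}
    (𝒬t : (Fin t → Ω₁) → Set (ProbabilityMeasure Ω₁))
    (Kt1star : (Fin (t + 1) → Ω₁) → Set (Fin d → ℝ)) (ω : Fin t → Ω₁) : Set (Fin d → ℝ) :=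
  {x | ∀ P ∈ 𝒬t ω, ∀ᵐ ω' ∂(P : Measure Ω₁), x ∈ dualCone (Kt1star (Fin.snoc ω ω'))}

open Filter Topology

/-- Inner approximation of the measure of a continuous image of a closed subset of Baire space by
the images of its coordinatewise bounded parts. -/
theorem exists_le_measure_image_inter_Iic {X : Type*} [TopologicalSpace X]
    [TopologicalSpace.MetrizableSpace X] [MeasurableSpace X] [OpensMeasurableSpace X]
    (ν : Measure X) [IsFiniteMeasure ν] {w : (ℕ → ℕ) → X} (hw : Continuous w)
    {F : Set (ℕ → ℕ)} (hF : IsClosed F) {c : ℝ≥0∞} (hc : c < ν (w '' F)) :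
    ∃ σ : ℕ → ℕ, c ≤ ν (w '' (F ∩ Iic σ)) := by
  let := TopologicalSpace.metrizableSpaceMetric X
  have step : ∀ (S : Set (ℕ → ℕ)) (n : ℕ), ∃ m : ℕ,
      c < ν (w '' S) → c < ν (w '' (S ∩ {τ | τ n ≤ m})) := by
    intro S n
    by_cases h : c < ν (w '' S)
    · have hmono : Monotone fun m : ℕ => w '' (S ∩ {τ | τ n ≤ m}) := fun a b hab =>
        image_mono (inter_subset_inter_right _ fun τ (hτ : τ n ≤ a) => hτ.trans hab)
      have hU : w '' S = ⋃ m : ℕ, w '' (S ∩ {τ | τ n ≤ m}) := by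
        rw [← image_iUnion, ← inter_iUnion]
        congr 1
        refine (inter_eq_left.2 fun τ _ => mem_iUnion.2 ⟨τ n, le_refl (τ n)⟩).symm
      rw [hU, hmono.measure_iUnion, lt_iSup_iff] at h
      obtain ⟨m, hm⟩ := h
      exact ⟨m, fun _ => hm⟩
    · exact ⟨0, fun h' => absurd h' h⟩
  choose m hm using step
  let C : ℕ → Set (ℕ → ℕ) := fun n => Nat.rec F (fun k S => S ∩ {τ | τ k ≤ m S k}) n
  have hC0 : C 0 = F := rfl
  have hCs : ∀ n, C (n + 1) = C n ∩ {τ | τ n ≤ m (C n) n} := fun _ => rfl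
  let σ : ℕ → ℕ := fun n => m (C n) n
  have hCm : ∀ n, c < ν (w '' C n) := by
    intro n
    induction n with
    | zero => exact hc
    | succ n ih => rw [hCs]; exact hm _ _ ih
  have hanti : Antitone C := antitone_nat_of_succ_le fun n => by
    rw [hCs]; exact inter_subset_left
  have hσ : ∀ i n, i < n → ∀ τ ∈ C n, τ i ≤ σ i := by
    intro i n hin τ hτ
    have := hanti (Nat.succ_le_of_lt hin) hτ
    exact this.2
  refine ⟨σ, ?_⟩
  have hsub : (⋂ n, closure (w '' C n)) ⊆ w '' (F ∩ Iic σ) := by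
    intro x hx
    have hx' : ∀ n : ℕ, ∃ τ ∈ C n, dist (w τ) x < 1 / ((n : ℝ) + 1) := by
      intro n
      obtain ⟨y, ⟨τ, hτ, rfl⟩, hy⟩ :=
        Metric.mem_closure_iff.1 (mem_iInter.1 hx n) _ (Nat.one_div_pos_of_nat (α := ℝ) (n := n))
      exact ⟨τ, hτ, by rwa [dist_comm]⟩
    choose τ hτC hτd using hx'
    let b : ℕ → ℕ := fun i => σ i + ∑ k ∈ Finset.range (i + 1), τ k i
    have hb : ∀ n, τ n ∈ Icc 0 b := by
      refine fun n => ⟨fun i => Nat.zero_le _, fun i => ?_⟩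
      by_cases hin : i < n
      · exact (hσ i n hin _ (hτC n)).trans (Nat.le_add_right _ _)
      · exact (Finset.single_le_sum (f := fun k => τ k i) (fun _ _ => Nat.zero_le _)
          (Finset.mem_range.2 (by omega))).trans (Nat.le_add_left _ _)
    obtain ⟨τ', -, φ, hφ, hlim⟩ := isCompact_Icc.tendsto_subseq hb
    have hdist : Tendsto (fun n => w (τ n)) atTop (𝓝 x) :=
      tendsto_iff_dist_tendsto_zero.2 <| squeeze_zero (fun _ => dist_nonneg)
        (fun n => (hτd n).le) tendsto_one_div_add_atTop_nhds_zero_nat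
    have hwlim : w τ' = x := tendsto_nhds_unique ((hw.tendsto τ').comp hlim)
      (hdist.comp hφ.tendsto_atTop)
    refine ⟨τ', ⟨?_, fun i => ?_⟩, hwlim⟩
    · exact hF.mem_of_tendsto hlim (Eventually.of_forall fun n => hanti (Nat.zero_le _) (hτC _))
    · have hi : Tendsto (fun n => (τ (φ n)) i) atTop (𝓝 (τ' i)) :=
        ((continuous_apply i).tendsto τ').comp hlim
      refine le_of_tendsto hi ?_
      filter_upwards [hφ.tendsto_atTop.eventually_gt_atTop i] with n hn
      exact hσ i _ hn _ (hτC _)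
  refine le_trans ?_ (measure_mono hsub)
  refine ge_of_tendsto' (tendsto_measure_iInter_atTop
    (fun n => isClosed_closure.measurableSet.nullMeasurableSet)
    (fun a b hab => closure_mono (image_mono (hanti hab))) ⟨0, measure_ne_top _ _⟩) fun n => ?_
  exact (hCm n).le.trans (measure_mono subset_closure)

/-- Analytic sets are measurable for the completion of every finite Borel measure. -/
theorem MeasureTheory.AnalyticSet.nullMeasurableSet {X : Type*} [TopologicalSpace X]
    [TopologicalSpace.MetrizableSpace X] [MeasurableSpace X] [OpensMeasurableSpace X]
    {A : Set X} (hA : AnalyticSet A) (ν : Measure X) [IsFiniteMeasure ν] :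
    NullMeasurableSet A ν := by
  rw [AnalyticSet] at hA
  rcases hA with rfl | ⟨w, hw, rfl⟩
  · exact MeasurableSet.empty.nullMeasurableSet
  rcases eq_or_ne (ν (range w)) 0 with h0 | h0
  · exact NullMeasurableSet.of_null h0
  obtain ⟨u, -, hu, hlim⟩ := exists_seq_strictMono_tendsto' (pos_iff_ne_zero.2 h0)
  have : ∀ n, ∃ σ : ℕ → ℕ, u n ≤ ν (w '' (univ ∩ Iic σ)) := fun n =>
    exists_le_measure_image_inter_Iic ν hw isClosed_univ (by rw [image_univ]; exact (hu n).2)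
  choose σ hσ using this
  have hcpt : ∀ n, IsCompact (w '' (univ ∩ Iic (σ n))) := fun n => by
    have : univ ∩ Iic (σ n) = Icc 0 (σ n) := by
      ext τ; simp
    rw [this]
    exact isCompact_Icc.image hw
  have hB : MeasurableSet (⋃ n, w '' (univ ∩ Iic (σ n))) :=
    MeasurableSet.iUnion fun n => (hcpt n).isClosed.measurableSet
  refine hB.nullMeasurableSet.congr (ae_eq_of_subset_of_measure_ge
    (iUnion_subset fun n => image_subset_range _ _) ?_ hB.nullMeasurableSet (measure_ne_top _ _))
  exact le_of_tendsto' hlim fun n => (hσ n).trans (measure_mono (subset_iUnion (fun n => w '' (univ ∩ Iic (σ n))) n))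

theorem measurable_toMeasure_of_continuous {Z X : Type*} [TopologicalSpace Z] [MeasurableSpace Z]
    [BorelSpace Z] [TopologicalSpace X] [MeasurableSpace X] [BorelSpace X] [HasOuterApproxClosed X]
    {P : Z → ProbabilityMeasure X} (hP : Continuous P) :
    Measurable fun z => (P z : Measure X) := by
  refine Measurable.measure_of_isPiSystem_of_isProbabilityMeasure
    (S := {s : Set X | IsClosed s}) ?_ isPiSystem_isClosed ?_
  · rw [BorelSpace.measurable_eq (α := X), borel_eq_generateFrom_isClosed]
  · intro F hF
    have hlim : ∀ z, Tendsto (fun n => ∫⁻ x, (hF.apprSeq n x : ℝ≥0∞) ∂(P z : Measure X)) atTop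
        (𝓝 ((P z : Measure X) F)) := fun z => HasOuterApproxClosed.tendsto_lintegral_apprSeq hF _
    refine measurable_of_tendsto_metrizable (fun n => ?_) (tendsto_pi_nhds.2 hlim)
    exact ((ProbabilityMeasure.continuous_lintegral_boundedContinuousFunction
      (hF.apprSeq n)).comp hP).measurable

/-- The set of parameters at which an analytic set has a non-null section is analytic. -/
theorem MeasureTheory.AnalyticSet.setOf_measure_section_ne_zero {Z X : Type*} [TopologicalSpace Z] [PolishSpace Z]
    [TopologicalSpace X] [PolishSpace X] [MeasurableSpace X] [BorelSpace X]
    {P : Z → ProbabilityMeasure X} (hP : Continuous P) {E : Set (Z × X)} (hE : AnalyticSet E) :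
    AnalyticSet {z | (P z : Measure X) {x | (z, x) ∈ E} ≠ 0} := by
  let : MeasurableSpace Z := borel Z
  have : BorelSpace Z := ⟨rfl⟩
  rw [AnalyticSet] at hE
  rcases hE with rfl | ⟨φ, hφ, rfl⟩
  · simp [analyticSet_empty]
  let G : Set (((ℕ → ℕ) × Z) × X) := {p | ∃ τ ≤ p.1.1, φ τ = (p.1.2, p.2)}
  have hG : IsClosed G := by
    let := TopologicalSpace.upgradeIsCompletelyMetrizable Z
    let := TopologicalSpace.upgradeIsCompletelyMetrizable X
    refine IsSeqClosed.isClosed fun p q hp hpq => ?_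
    choose τ hτ hτφ using hp
    have h1 : Tendsto (fun n => (p n).1.1) atTop (𝓝 q.1.1) :=
      ((continuous_fst.comp continuous_fst).tendsto q).comp hpq
    have h2 : Tendsto (fun n => ((p n).1.2, (p n).2)) atTop (𝓝 (q.1.2, q.2)) :=
      (((continuous_snd.comp continuous_fst).prodMk continuous_snd).tendsto q).comp hpq
    have hbdd : ∀ i, ∃ b, ∀ n, (p n).1.1 i ≤ b := fun i => by
      obtain ⟨b, hb⟩ := (((continuous_apply i).tendsto q.1.1).comp h1).bddAbove_range
      exact ⟨b, fun n => hb ⟨n, rfl⟩⟩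
    choose b hb using hbdd
    obtain ⟨τ', -, ψ, hψ, hlim⟩ := (isCompact_Icc (a := (0 : ℕ → ℕ)) (b := b)).tendsto_subseq
      (x := τ) fun n => ⟨fun i => Nat.zero_le _, fun i => (hτ n i).trans (hb i n)⟩
    refine ⟨τ', ?_, ?_⟩
    · exact le_of_tendsto_of_tendsto' hlim (h1.comp hψ.tendsto_atTop) fun n => hτ _
    · refine tendsto_nhds_unique ((hφ.tendsto τ').comp hlim) ?_
      refine (h2.comp hψ.tendsto_atTop).congr fun n => ?_
      exact (hτφ (ψ n)).symm
  let κ : ProbabilityTheory.Kernel ((ℕ → ℕ) × Z) X :=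
    ⟨fun p => (P p.2 : Measure X), (measurable_toMeasure_of_continuous hP).comp measurable_snd⟩
  have : ProbabilityTheory.IsMarkovKernel κ := ⟨fun p => by
    change IsProbabilityMeasure (P p.2 : Measure X); infer_instance⟩
  have hmeas : MeasurableSet {p : (ℕ → ℕ) × Z | κ p (Prod.mk p ⁻¹' G) ≠ 0} :=
    (ProbabilityTheory.Kernel.measurable_kernel_prodMk_left hG.measurableSet
      (measurableSet_singleton 0)).compl
  convert hmeas.analyticSet.image_of_continuous continuous_snd using 1
  ext z
  simp only [mem_ofPred_eq, mem_image, Prod.exists, exists_eq_right]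
  constructor
  · intro hz
    have himg : {x | (z, x) ∈ range φ} = (Prod.snd ∘ φ) '' {τ | (φ τ).1 = z} := by
      ext x
      constructor
      · rintro ⟨τ, hτ⟩
        exact ⟨τ, by simp [hτ], by simp [hτ]⟩
      · rintro ⟨τ, hτ, rfl⟩
        exact ⟨τ, Prod.ext hτ rfl⟩
    rw [himg] at hz
    obtain ⟨c, hc0, hc⟩ := exists_between (pos_iff_ne_zero.2 hz)
    obtain ⟨σ, hσ⟩ := exists_le_measure_image_inter_Iic (P z : Measure X)
      (continuous_snd.comp hφ)
      (isClosed_eq (continuous_fst.comp hφ) continuous_const) hc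
    refine ⟨σ, fun h0 => hc0.not_ge (hσ.trans ((measure_mono ?_).trans h0.le))⟩
    rintro _ ⟨τ, ⟨hτ1, hτ2⟩, rfl⟩
    exact ⟨τ, hτ2, Prod.ext hτ1 rfl⟩
  · rintro ⟨σ, hσ⟩ h0
    refine hσ (measure_mono_null ?_ h0)
    rintro x ⟨τ, -, hτ⟩
    exact ⟨τ, hτ⟩

theorem abs_sum_mul_le {d : ℕ} (x a : Fin d → ℝ) : |∑ i, x i * a i| ≤ d * ‖x‖ * ‖a‖ := by
  calc |∑ i, x i * a i| ≤ ∑ i, |x i * a i| := Finset.abs_sum_le_sum_abs _ _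
    _ ≤ ∑ _i : Fin d, ‖x‖ * ‖a‖ := Finset.sum_le_sum fun i _ => by
        rw [abs_mul]
        exact mul_le_mul (norm_le_pi_norm x i) (norm_le_pi_norm a i) (abs_nonneg _) (norm_nonneg _)
    _ = d * ‖x‖ * ‖a‖ := by simp [mul_assoc]

theorem neg_sum_mul_div_le {d : ℕ} (x a : Fin d → ℝ) :
    -(∑ i, x i * a i) / (1 + ‖a‖) ≤ d * ‖x‖ := by
  have ha := norm_nonneg a
  rw [div_le_iff₀ (by positivity)]
  have h1 := neg_le_abs (∑ i, x i * a i)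
  have h2 := abs_sum_mul_le x a
  have h3 : 0 ≤ (d : ℝ) * ‖x‖ := by positivity
  nlinarith

/-- A Lipschitz function of `x` measuring by how much `x` fails to lie in the dual cone of `A`. -/
def coneGap {d : ℕ} (A : Set (Fin d → ℝ)) (x : Fin d → ℝ) : ℝ :=
  ⨆ a : A, max 0 (-(∑ i, x i * (a : Fin d → ℝ) i) / (1 + ‖(a : Fin d → ℝ)‖))

theorem coneGap_nonneg {d : ℕ} (A : Set (Fin d → ℝ)) (x : Fin d → ℝ) : 0 ≤ coneGap A x :=
  Real.iSup_nonneg fun _ => le_max_left _ _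

theorem coneGap_le {d : ℕ} (A : Set (Fin d → ℝ)) (x : Fin d → ℝ) : coneGap A x ≤ d * ‖x‖ :=
  Real.iSup_le (fun a => max_le (by positivity) (neg_sum_mul_div_le x a)) (by positivity)

theorem lt_coneGap_iff {d : ℕ} {A : Set (Fin d → ℝ)} {x : Fin d → ℝ} {c : ℝ} (hc : 0 ≤ c) :
    c < coneGap A x ↔ ∃ a ∈ A, c < -(∑ i, x i * a i) / (1 + ‖a‖) := by
  constructor
  · intro h
    by_contra! hcon
    exact h.not_ge (Real.iSup_le (fun a => max_le hc (hcon a a.2)) hc)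
  · rintro ⟨a, ha, h⟩
    refine h.trans_le ((le_max_right 0 _).trans (le_ciSup (f := fun a : A =>
      max 0 (-(∑ i, x i * (a : Fin d → ℝ) i) / (1 + ‖(a : Fin d → ℝ)‖))) ?_ ⟨a, ha⟩))
    refine ⟨d * ‖x‖, ?_⟩
    rintro _ ⟨b, rfl⟩
    exact max_le (by positivity) (neg_sum_mul_div_le x b)

theorem coneGap_le_zero_iff {d : ℕ} {A : Set (Fin d → ℝ)} {x : Fin d → ℝ} :
    coneGap A x ≤ 0 ↔ x ∈ dualCone A := by
  rw [← not_lt, lt_coneGap_iff le_rfl]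
  have key : ∀ a : Fin d → ℝ, 0 < -(∑ i, x i * a i) / (1 + ‖a‖) ↔ ∑ i, a i * x i < 0 := fun a => by
    have ha := norm_nonneg a
    rw [div_pos_iff_of_pos_right (by positivity), neg_pos]
    simp only [mul_comm]
  simp only [key, not_exists, not_and, not_lt]
  rfl

theorem coneGap_le_add {d : ℕ} (A : Set (Fin d → ℝ)) (x y : Fin d → ℝ) :
    coneGap A x ≤ coneGap A y + d * ‖x - y‖ := by
  by_contra! h
  have h0 := coneGap_nonneg A y
  obtain ⟨a, ha, h⟩ := (lt_coneGap_iff (by positivity)).1 h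
  refine lt_irrefl (coneGap A y) ((lt_coneGap_iff h0).2 ⟨a, ha, ?_⟩)
  have h1 := neg_sum_mul_div_le (x - y) a
  have h2 : -(∑ i, x i * a i) / (1 + ‖a‖) =
      -(∑ i, y i * a i) / (1 + ‖a‖) + -(∑ i, (x - y) i * a i) / (1 + ‖a‖) := by
    rw [← add_div, ← neg_add, ← Finset.sum_add_distrib]
    congr 2
    exact Finset.sum_congr rfl fun i _ => by simp [← add_mul]
  linarith

theorem continuous_of_le_add_mul_norm {E : Type*} [SeminormedAddCommGroup E] {g : E → ℝ} {C : ℝ}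
    (hC : 0 ≤ C) (hg : ∀ x y, g x ≤ g y + C * ‖x - y‖) : Continuous g :=
  (LipschitzWith.of_le_add_mul ⟨C, hC⟩ fun x y => by
    rw [dist_eq_norm]; exact hg x y).continuous

theorem continuous_coneGap {d : ℕ} (A : Set (Fin d → ℝ)) : Continuous (coneGap A) :=
  continuous_of_le_add_mul_norm d.cast_nonneg (coneGap_le_add A)

/-- The quasi-sure essential supremum of a nonnegative function over a set of probability
measures. -/
def qsSup {α : Type*} [MeasurableSpace α] (Q : Set (ProbabilityMeasure α)) (φ : α → ℝ) : ℝ :=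
  sInf {c | 0 ≤ c ∧ ∀ P ∈ Q, ∀ᵐ x ∂(P : Measure α), φ x ≤ c}

theorem qsSup_nonneg {α : Type*} [MeasurableSpace α] (Q : Set (ProbabilityMeasure α)) (φ : α → ℝ) :
    0 ≤ qsSup Q φ := Real.sInf_nonneg fun _ h => h.1

theorem lt_qsSup_iff {α : Type*} [MeasurableSpace α] {Q : Set (ProbabilityMeasure α)} {φ : α → ℝ}
    {C c : ℝ} (hφ : ∀ x, φ x ≤ C) (hc : 0 ≤ c) :
    c < qsSup Q φ ↔ ∃ P ∈ Q, (P : Measure α) {x | c < φ x} ≠ 0 := by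
  have hnull : ∀ (P : ProbabilityMeasure α) (b : ℝ), (∀ᵐ x ∂(P : Measure α), φ x ≤ b) ↔
      (P : Measure α) {x | b < φ x} = 0 := fun P b => by
    rw [ae_iff]; simp only [not_le]
  have hbdd : BddBelow {c | 0 ≤ c ∧ ∀ P ∈ Q, ∀ᵐ x ∂(P : Measure α), φ x ≤ c} := ⟨0, fun _ h => h.1⟩
  constructor
  · intro h
    by_contra! hcon
    exact h.not_ge (csInf_le hbdd ⟨hc, fun P hP => (hnull P c).2 (hcon P hP)⟩)
  · rintro ⟨P, hP, h⟩
    by_contra! hcon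
    refine h ((hnull P c).1 ?_)
    have : ∀ n : ℕ, ∀ᵐ x ∂(P : Measure α), φ x ≤ c + 1 / ((n : ℝ) + 1) := by
      intro n
      have hlt : sInf {c | 0 ≤ c ∧ ∀ P ∈ Q, ∀ᵐ x ∂(P : Measure α), φ x ≤ c} <
          c + 1 / ((n : ℝ) + 1) :=
        hcon.trans_lt (lt_add_of_pos_right _ Nat.one_div_pos_of_nat)
      obtain ⟨b, hb, hbc⟩ := exists_lt_of_csInf_lt (by
        exact ⟨max 0 C, le_max_left _ _, fun P _ => ae_of_all _ fun x =>
          (hφ x).trans (le_max_right _ _)⟩) hlt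
      filter_upwards [hb.2 P hP] with x hx using hx.trans hbc.le
    filter_upwards [ae_all_iff.2 this] with x hx
    refine ge_of_tendsto' (f := fun n : ℕ => c + 1 / ((n : ℝ) + 1)) (x := atTop) ?_ hx
    simpa using tendsto_const_nhds.add (tendsto_one_div_add_atTop_nhds_zero_nat (𝕜 := ℝ))

theorem qsSup_le_zero_iff {α : Type*} [MeasurableSpace α] {Q : Set (ProbabilityMeasure α)}
    {φ : α → ℝ} {C : ℝ} (hφ : ∀ x, φ x ≤ C) :
    qsSup Q φ ≤ 0 ↔ ∀ P ∈ Q, ∀ᵐ x ∂(P : Measure α), φ x ≤ 0 := by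
  rw [← not_lt, lt_qsSup_iff hφ le_rfl]
  simp only [ae_iff, not_exists, not_and, not_not, not_le, ne_eq]

theorem qsSup_le_add {α : Type*} [MeasurableSpace α] (Q : Set (ProbabilityMeasure α))
    {φ φ' : α → ℝ} {C C' δ : ℝ} (hφ : ∀ x, φ x ≤ C) (hφ' : ∀ x, φ' x ≤ C') (hδ : 0 ≤ δ)
    (h : ∀ x, φ x ≤ φ' x + δ) : qsSup Q φ ≤ qsSup Q φ' + δ := by
  by_contra! hlt
  have h0 := qsSup_nonneg Q φ'
  obtain ⟨P, hP, hne⟩ := (lt_qsSup_iff hφ (by positivity)).1 hlt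
  refine lt_irrefl (qsSup Q φ') ((lt_qsSup_iff hφ' h0).2 ⟨P, hP, fun hz => hne ?_⟩)
  refine measure_mono_null (fun x hx => ?_) hz
  have hx' : qsSup Q φ' + δ < φ x := hx
  have := h x
  change qsSup Q φ' < φ' x
  linarith

/-- The bipolar theorem for closed convex cones in `ℝ^d`. -/
theorem dualCone_dualCone {d : ℕ} {K : Set (Fin d → ℝ)} (hcl : IsClosed K) (hconv : Convex ℝ K)
    (hcone : ∀ c : ℝ, 0 ≤ c → ∀ x ∈ K, c • x ∈ K) (h0 : (0 : Fin d → ℝ) ∈ K) :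
    dualCone (dualCone K) = K := by
  refine Subset.antisymm (fun x hx => ?_) fun x hx y hy => ?_
  · by_contra hxK
    obtain ⟨l, u, hlx, hl⟩ := geometric_hahn_banach_point_closed hconv hcl hxK
    have hu : u < 0 := by simpa using hl 0 h0
    have hlsum : ∀ z : Fin d → ℝ, l z = ∑ i, z i * l (Pi.single i 1) := fun z => by
      conv_lhs => rw [pi_eq_sum_univ' z]
      simp [map_sum]
    have hpos : ∀ z ∈ K, 0 ≤ l z := by
      intro z hz
      by_contra! hneg
      have := hl _ (hcone (u / l z) (div_nonneg_of_nonpos hu.le hneg.le) z hz)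
      rw [map_smul, smul_eq_mul, div_mul_cancel₀ _ hneg.ne] at this
      exact lt_irrefl _ this
    have hy : (fun i => l (Pi.single i 1)) ∈ dualCone K := fun z hz => by
      rw [← hlsum]; exact hpos z hz
    have := hx _ hy
    simp only [mul_comm] at this
    rw [← hlsum] at this
    linarith
  · have := hy x hx
    simpa only [mul_comm] using this

theorem convex_dualCone {d : ℕ} (A : Set (Fin d → ℝ)) : Convex ℝ (dualCone A) := by
  intro x hx y hy a b ha hb _ z hz
  have : ∑ i, z i * (a • x + b • y) i = a * ∑ i, z i * x i + b * ∑ i, z i * y i := by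
    rw [Finset.mul_sum, Finset.mul_sum, ← Finset.sum_add_distrib]
    exact Finset.sum_congr rfl fun i _ => by simp; ring
  rw [this]
  exact add_nonneg (mul_nonneg ha (hx z hz)) (mul_nonneg hb (hy z hz))

theorem measurableSet_setOf_exists_mem_eq_zero {Ω E : Type*} [MeasurableSpace Ω]
    [TopologicalSpace E] [SecondCountableTopology E] {φ : Ω → E → ℝ} (hφ0 : ∀ ω x, 0 ≤ φ ω x)
    (hφm : ∀ x, Measurable fun ω => φ ω x) (hφc : ∀ ω, Continuous (φ ω)) {B : Set E}
    (hB : IsCompact B) : MeasurableSet {ω | ∃ x ∈ B, φ ω x = 0} := by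
  rcases B.eq_empty_or_nonempty with rfl | hne
  · simp
  have : Nonempty B := hne.to_subtype
  let u := TopologicalSpace.denseSeq B
  have hset : {ω | ∃ x ∈ B, φ ω x = 0} =
      ⋂ n : ℕ, ⋃ k : ℕ, {ω | φ ω (u k) < 1 / ((n : ℝ) + 1)} := by
    ext ω
    simp only [mem_ofPred_eq, mem_iInter, mem_iUnion]
    constructor
    · rintro ⟨x, hx, h0⟩ n
      have hopen : IsOpen {y : B | φ ω y < 1 / ((n : ℝ) + 1)} :=
        isOpen_lt ((hφc ω).comp continuous_subtype_val) continuous_const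
      have hxm : φ ω x < 1 / ((n : ℝ) + 1) := by
        rw [h0]; exact Nat.one_div_pos_of_nat
      exact (TopologicalSpace.denseRange_denseSeq B).exists_mem_open hopen ⟨⟨x, hx⟩, hxm⟩
    · intro h
      obtain ⟨x, hx, hmin⟩ := hB.exists_isMinOn hne (hφc ω).continuousOn
      refine ⟨x, hx, le_antisymm ?_ (hφ0 ω x)⟩
      refine ge_of_tendsto' (tendsto_one_div_add_atTop_nhds_zero_nat (𝕜 := ℝ)) fun n => ?_
      obtain ⟨k, hk⟩ := h n
      exact (hmin (u k).2).trans hk.le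
  rw [hset]
  exact MeasurableSet.iInter fun n => MeasurableSet.iUnion fun k =>
    measurableSet_lt (hφm _) measurable_const

/-- A measurable family of continuous nonnegative functions on `ℝ^d` with convex zero sets admits a
measurable selection of zeros: the zeros of least Euclidean norm. -/
theorem exists_measurable_zero_of_convex {Ω : Type*} [MeasurableSpace Ω] {d : ℕ}
    {φ : Ω → (Fin d → ℝ) → ℝ} (hφ0 : ∀ ω x, 0 ≤ φ ω x)
    (hφm : ∀ x, Measurable fun ω => φ ω x) (hφc : ∀ ω, Continuous (φ ω))
    (hφconv : ∀ ω, Convex ℝ {x | φ ω x = 0}) :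
    ∃ g : Ω → Fin d → ℝ, Measurable g ∧ ∀ ω, (∃ x, φ ω x = 0) → φ ω (g ω) = 0 := by
  let N : (Fin d → ℝ) → ℝ := fun x => ∑ i, x i ^ 2
  have hNc : Continuous N := by fun_prop
  have hN0 : ∀ x, 0 ≤ N x := fun x => Finset.sum_nonneg fun i _ => sq_nonneg _
  have hNcpt : ∀ s, IsCompact {x | N x ≤ s} := by
    intro s
    refine Metric.isCompact_of_isClosed_isBounded (isClosed_le hNc continuous_const) ?_
    refine (Metric.isBounded_closedBall (x := (0 : Fin d → ℝ)) (r := √s)).subset fun x hx => ?_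
    rw [mem_closedBall_zero_iff, pi_norm_le_iff_of_nonneg (Real.sqrt_nonneg _)]
    intro i
    refine Real.abs_le_sqrt (le_trans ?_ hx)
    exact Finset.single_le_sum (f := fun i => x i ^ 2) (fun i _ => sq_nonneg _)
      (Finset.mem_univ i)
  have hmin : ∀ ω, ∃ x, (∃ x, φ ω x = 0) → φ ω x = 0 ∧ ∀ y, φ ω y = 0 → N x ≤ N y := by
    intro ω
    by_cases h : ∃ x, φ ω x = 0
    · obtain ⟨x₀, hx₀⟩ := h
      obtain ⟨x, hx, hxmin⟩ := ((hNcpt (N x₀)).inter_right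
        (isClosed_eq (hφc ω) continuous_const)).exists_isMinOn ⟨x₀, le_refl (N x₀), hx₀⟩
        hNc.continuousOn
      refine ⟨x, fun _ => ⟨hx.2, fun y hy => ?_⟩⟩
      rcases le_total (N y) (N x₀) with hle | hle
      · exact hxmin ⟨hle, hy⟩
      · exact le_trans hx.1 hle
    · exact ⟨0, fun h' => absurd h' h⟩
  choose m hm using hmin
  have huniq : ∀ ω, (∃ x, φ ω x = 0) → ∀ y, φ ω y = 0 → N y ≤ N (m ω) → y = m ω := by
    intro ω h y hy hle
    obtain ⟨hm0, hmle⟩ := hm ω h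
    have hmid := hmle _ (hφconv ω hm0 hy (by norm_num : (0 : ℝ) ≤ 1 / 2)
      (by norm_num : (0 : ℝ) ≤ 1 / 2) (by norm_num))
    have hpar : N ((1 / 2 : ℝ) • m ω + (1 / 2 : ℝ) • y) =
        N (m ω) / 2 + N y / 2 - N (y - m ω) / 4 := by
      simp only [N, Finset.sum_div, ← Finset.sum_add_distrib, ← Finset.sum_sub_distrib]
      exact Finset.sum_congr rfl fun i _ => by simp; ring
    have hz : N (y - m ω) = 0 := le_antisymm (by linarith) (hN0 _)
    rw [Finset.sum_eq_zero_iff_of_nonneg fun i _ => sq_nonneg _] at hz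
    funext i
    exact sub_eq_zero.1 (pow_eq_zero_iff two_ne_zero |>.1 (hz i (Finset.mem_univ i)))
  let D : Set Ω := {ω | ∃ x, φ ω x = 0}
  have hD : MeasurableSet D := by
    have : D = ⋃ n : ℕ, {ω | ∃ x ∈ Metric.closedBall (0 : Fin d → ℝ) n, φ ω x = 0} := by
      ext ω
      simp only [mem_iUnion, D]
      constructor
      · rintro ⟨x, hx⟩
        obtain ⟨n, hn⟩ := exists_nat_ge ‖x‖
        exact ⟨n, x, by simpa using hn, hx⟩
      · rintro ⟨n, x, -, hx⟩
        exact ⟨x, hx⟩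
    rw [this]
    exact MeasurableSet.iUnion fun n =>
      measurableSet_setOf_exists_mem_eq_zero hφ0 hφm hφc (isCompact_closedBall _ _)
  classical
  let g : Ω → Fin d → ℝ := fun ω => if ω ∈ D then m ω else 0
  have hgD : ∀ ω ∈ D, g ω = m ω := fun ω hω => if_pos hω
  have hgDc : ∀ ω ∉ D, g ω = 0 := fun ω hω => if_neg hω
  have hNg : Measurable fun ω => N (g ω) := by
    refine measurable_of_Iic fun s => ?_
    have : (fun ω => N (g ω)) ⁻¹' Iic s =
        {ω | ∃ x ∈ {x | N x ≤ s}, φ ω x = 0} ∪ (Dᶜ ∩ {_ω | N 0 ≤ s}) := by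
      ext ω
      by_cases hω : ω ∈ D
      · simp only [mem_preimage, mem_Iic, hgD ω hω, mem_union, mem_inter_iff, mem_compl_iff, hω,
          not_true_eq_false, false_and, or_false]
        exact ⟨fun h => ⟨m ω, h, (hm ω hω).1⟩, fun ⟨x, hx, h0⟩ => ((hm ω hω).2 x h0).trans hx⟩
      · simp only [mem_preimage, mem_Iic, hgDc ω hω, mem_union, mem_inter_iff, mem_compl_iff, hω,
          not_false_eq_true, true_and]
        exact ⟨Or.inr, fun h => h.elim (fun ⟨x, _, h0⟩ => absurd ⟨x, h0⟩ hω) id⟩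
    rw [this]
    exact (measurableSet_setOf_exists_mem_eq_zero hφ0 hφm hφc (hNcpt s)).union
      (hD.compl.inter (MeasurableSet.const _))
  have hgcpt : ∀ B : Set (Fin d → ℝ), IsCompact B → MeasurableSet (g ⁻¹' B) := by
    intro B hB
    have hφ' := measurableSet_setOf_exists_mem_eq_zero
      (φ := fun ω x => φ ω x + |N x - N (g ω)|)
      (fun ω x => add_nonneg (hφ0 ω x) (abs_nonneg _))
      (fun x => (hφm x).add (measurable_const.sub hNg).abs)
      (fun ω => (hφc ω).add (hNc.sub continuous_const).abs) hB
    have : g ⁻¹' B = (D ∩ {ω | ∃ x ∈ B, φ ω x + |N x - N (g ω)| = 0}) ∪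
        (Dᶜ ∩ {_ω | (0 : Fin d → ℝ) ∈ B}) := by
      ext ω
      by_cases hω : ω ∈ D
      · simp only [mem_preimage, hgD ω hω, mem_union, mem_inter_iff, mem_compl_iff, hω,
          not_true_eq_false, false_and, or_false, true_and, mem_ofPred_eq]
        constructor
        · exact fun h => ⟨m ω, h, by simp [(hm ω hω).1]⟩
        · rintro ⟨x, hx, h0⟩
          have h1 := hφ0 ω x
          have h2 := abs_nonneg (N x - N (m ω))
          have h3 : |N x - N (m ω)| = 0 := by linarith
          rw [abs_eq_zero, sub_eq_zero] at h3
          rwa [← huniq ω hω x (by linarith) h3.le]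
      · simp [hgDc ω hω, hω]
    rw [this]
    exact (hD.inter hφ').union (hD.compl.inter (MeasurableSet.const _))
  refine ⟨g, measurable_of_isClosed fun B hB => ?_, fun ω h => ?_⟩
  · have : B = ⋃ n : ℕ, B ∩ Metric.closedBall 0 n := by
      rw [← inter_iUnion, Metric.iUnion_closedBall_nat, inter_univ]
    rw [this, preimage_iUnion]
    exact MeasurableSet.iUnion fun n => hgcpt _ ((isCompact_closedBall _ _).inter_left hB)
  · rw [hgD ω h]
    exact (hm ω h).1

theorem exists_measurable_decomposition {Ω : Type*} [MeasurableSpace Ω] {d : ℕ}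
    {φ ψ : Ω → (Fin d → ℝ) → ℝ} (hφ0 : ∀ ω x, 0 ≤ φ ω x) (hψ0 : ∀ ω x, 0 ≤ ψ ω x)
    (hφm : ∀ x, Measurable fun ω => φ ω x) (hψm : ∀ x, Measurable fun ω => ψ ω x)
    (hφc : ∀ ω, Continuous (φ ω)) (hψc : ∀ ω, Continuous (ψ ω))
    {K L : Ω → Set (Fin d → ℝ)} (hK : ∀ ω x, φ ω x ≤ 0 ↔ x ∈ K ω)
    (hL : ∀ ω x, ψ ω x ≤ 0 ↔ x ∈ L ω) (hKconv : ∀ ω, Convex ℝ (K ω))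
    (hLconv : ∀ ω, Convex ℝ (L ω)) (hK0 : ∀ ω, 0 ∈ K ω) (hL0 : ∀ ω, 0 ∈ L ω)
    {f : Ω → Fin d → ℝ} (hf : Measurable f) :
    ∃ g h : Ω → Fin d → ℝ, Measurable g ∧ Measurable h ∧ (∀ ω, g ω ∈ K ω) ∧ (∀ ω, h ω ∈ L ω) ∧
      ∀ ω, f ω ∈ K ω + L ω → f ω = g ω + h ω := by
  classical
  have hφu : Measurable (Function.uncurry fun x ω => φ ω x) :=
    measurable_uncurry_of_continuous_of_measurable hφc hφm
  have hψu : Measurable (Function.uncurry fun x ω => ψ ω x) :=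
    measurable_uncurry_of_continuous_of_measurable hψc hψm
  let χ : Ω → (Fin d → ℝ) → ℝ := fun ω x => φ ω x + ψ ω (f ω - x)
  have hχ : ∀ ω x, χ ω x = 0 ↔ x ∈ K ω ∧ f ω - x ∈ L ω := fun ω x => by
    rw [← hK, ← hL, add_eq_zero_iff_of_nonneg (hφ0 _ _) (hψ0 _ _),
      (hφ0 ω x).ge_iff_eq', (hψ0 ω (f ω - x)).ge_iff_eq']
  have hχm : ∀ {k : Ω → Fin d → ℝ}, Measurable k → Measurable fun ω => χ ω (k ω) := fun hk =>
    (hφu.comp (hk.prodMk measurable_id)).add (hψu.comp ((hf.sub hk).prodMk measurable_id))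
  have hconv : ∀ ω, Convex ℝ {x | χ ω x = 0} := by
    intro ω x hx y hy a b ha hb hab
    have hx' := (hχ ω x).1 hx
    have hy' := (hχ ω y).1 hy
    refine (hχ ω _).2 ⟨hKconv ω hx'.1 hy'.1 ha hb hab, ?_⟩
    have : f ω - (a • x + b • y) = a • (f ω - x) + b • (f ω - y) := by
      nth_rewrite 1 [← one_smul ℝ (f ω)]
      rw [← hab, add_smul, smul_sub, smul_sub]
      abel
    rw [this]
    exact hLconv ω hx'.2 hy'.2 ha hb hab
  obtain ⟨k, hk, hkz⟩ := exists_measurable_zero_of_convex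
    (fun ω x => add_nonneg (hφ0 ω x) (hψ0 ω _)) (fun x => hχm measurable_const)
    (fun ω => (hφc ω).add ((hψc ω).comp (continuous_const.sub continuous_id))) hconv
  have hD : MeasurableSet {ω | χ ω (k ω) = 0} := hχm hk (measurableSet_singleton 0)
  refine ⟨fun ω => if χ ω (k ω) = 0 then k ω else 0,
    fun ω => if χ ω (k ω) = 0 then f ω - k ω else 0, Measurable.ite hD hk measurable_const,
    Measurable.ite hD (hf.sub hk) measurable_const, fun ω => ?_, fun ω => ?_, fun ω hω => ?_⟩
  · by_cases h : χ ω (k ω) = 0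
    · simpa only [h, if_true] using ((hχ ω _).1 h).1
    · simpa only [h, if_false] using hK0 ω
  · by_cases h : χ ω (k ω) = 0
    · simpa only [h, if_true] using ((hχ ω _).1 h).2
    · simpa only [h, if_false] using hL0 ω
  · obtain ⟨x, hx, y, hy, hxy⟩ := mem_add.1 hω
    have h : χ ω (k ω) = 0 := hkz ω ⟨x, (hχ ω x).2 ⟨hx, by rwa [← hxy, add_sub_cancel_left]⟩⟩
    simp only [h, if_true, add_sub_cancel]

theorem Measurable.univComp {α β : Type*} [MeasurableSpace α] [MeasurableSpace β] {f : α → β}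
    (hf : Measurable f) : @Measurable α β (univComp α) (univComp β) f := by
  intro s hs μ hμ
  exact (hs (μ.map f) (Measure.isProbabilityMeasure_map hf.aemeasurable)).preimage
    ⟨hf, Measure.AbsolutelyContinuous.rfl⟩

theorem MeasureTheory.AnalyticSet.univMeasurableSet {X : Type*} [TopologicalSpace X] [PolishSpace X]
    [MeasurableSpace X] [BorelSpace X] {A : Set X} (hA : AnalyticSet A) : UnivMeasurableSet A :=
  fun μ _ => hA.nullMeasurableSet μ

theorem UnivMeasurableSet.nullMeasurableSet {α : Type*} [MeasurableSpace α] {s : Set α}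
    (hs : UnivMeasurableSet s) (μ : Measure α) [IsFiniteMeasure μ] : NullMeasurableSet s μ := by
  rcases eq_or_ne μ 0 with rfl | hμ
  · exact NullMeasurableSet.of_null rfl
  · have : NeZero μ := ⟨hμ⟩
    refine (hs ((μ univ)⁻¹ • μ) inferInstance).mono_ac fun t ht => ?_
    simpa [measure_ne_top] using ht

theorem univMeasurable_of_analyticSet {X : Type*} [TopologicalSpace X] [PolishSpace X]
    [MeasurableSpace X] [BorelSpace X] {φ : X → ℝ} (h0 : ∀ x, 0 ≤ φ x)
    (h : ∀ c, 0 ≤ c → AnalyticSet {x | c < φ x}) : UnivMeasurable φ := by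
  refine @measurable_of_Ioi ℝ X _ _ _ (univComp X) _ _ _ _ fun c => ?_
  rcases lt_or_ge c 0 with hc | hc
  · have : φ ⁻¹' Ioi c = univ := eq_univ_of_forall fun x => hc.trans_le (h0 x)
    rw [this]
    exact MeasurableSet.univ
  · exact (h c hc).univMeasurableSet

theorem analyticSet_setOf_lt_coneGap {X : Type*} [TopologicalSpace X] [PolishSpace X] {d : ℕ}
    {A : X → Set (Fin d → ℝ)} (hA : AnalyticSet {q : X × (Fin d → ℝ) | q.2 ∈ A q.1})
    (x : Fin d → ℝ) {c : ℝ} (hc : 0 ≤ c) : AnalyticSet {q | c < coneGap (A q) x} := by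
  have hopen : IsOpen {q : X × (Fin d → ℝ) | c < -(∑ i, x i * q.2 i) / (1 + ‖q.2‖)} :=
    isOpen_lt continuous_const <| Continuous.div (by fun_prop) (by fun_prop) fun q => by positivity
  let B : Bool → Set (X × (Fin d → ℝ)) := fun b => bif b then {q | q.2 ∈ A q.1} else
    {q | c < -(∑ i, x i * q.2 i) / (1 + ‖q.2‖)}
  have hB : ∀ b, AnalyticSet (B b) := fun b => match b with
    | true => hA
    | false => by simpa [B] using hopen.analyticSet_image continuous_id
  convert (AnalyticSet.iInter hB).image_of_continuous continuous_fst using 1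
  ext q
  simp only [mem_ofPred_eq, lt_coneGap_iff hc, mem_image]
  exact ⟨fun ⟨a, ha, h⟩ => ⟨(q, a), mem_iInter.2 (Bool.forall_bool.2 ⟨h, ha⟩), rfl⟩,
    fun ⟨⟨q', a⟩, h, hq⟩ => hq ▸ ⟨a, mem_iInter.1 h true, mem_iInter.1 h false⟩⟩

/-- The strict superlevel sets of the quasi-sure essential supremum of an analytic family are
analytic. -/
theorem analyticSet_setOf_lt_qsSup {X Y : Type*} [TopologicalSpace X] [PolishSpace X]
    [TopologicalSpace Y] [PolishSpace Y] [MeasurableSpace Y] [BorelSpace Y]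
    {Q : X → Set (ProbabilityMeasure Y)}
    (hQ : AnalyticSet {p : X × ProbabilityMeasure Y | p.2 ∈ Q p.1}) {φ : X → Y → ℝ} {C c : ℝ}
    (hφ : ∀ x y, φ x y ≤ C) (hc : 0 ≤ c) (hφa : AnalyticSet {p : X × Y | c < φ p.1 p.2}) :
    AnalyticSet {x | c < qsSup (Q x) (φ x)} := by
  simp only [lt_qsSup_iff (hφ _) hc]
  rw [AnalyticSet] at hQ
  rcases hQ with hQ | ⟨u, hu, hur⟩
  · have : ∀ x, Q x = ∅ := fun x => eq_empty_of_forall_notMem fun P hP =>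
      (hQ ▸ (show (x, P) ∈ {p : X × ProbabilityMeasure Y | p.2 ∈ Q p.1} from hP) :
        (x, P) ∈ (∅ : Set _))
    simp [this, analyticSet_empty]
  · have hE := AnalyticSet.setOf_measure_section_ne_zero (continuous_snd.comp hu)
      (hφa.preimage (f := fun p : (ℕ → ℕ) × Y => ((u p.1).1, p.2)) (by fun_prop))
    convert hE.image_of_continuous (continuous_fst.comp hu) using 1
    ext x
    constructor
    · rintro ⟨P, hP, h⟩
      obtain ⟨r, hr⟩ : (x, P) ∈ range u := hur ▸ hP
      exact ⟨r, by simpa [hr] using h, by simp [hr]⟩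
    · rintro ⟨r, h, rfl⟩
      have : u r ∈ {p : X × ProbabilityMeasure Y | p.2 ∈ Q p.1} := hur ▸ mem_range_self r
      exact ⟨(u r).2, this, h⟩

theorem prodMeas_univ_le {Ω₁ : Type*} [MeasurableSpace Ω₁]
    (P : (t : ℕ) → (Fin t → Ω₁) → ProbabilityMeasure Ω₁) (T : ℕ) :
    prodMeas (fun t ω => (P t ω : Measure Ω₁)) T univ ≤ 1 := by
  induction T with
  | zero => simp [prodMeas]
  | succ T ih =>
    refine (Measure.bind_apply_le _ MeasurableSet.univ).trans ?_
    refine (lintegral_mono (g := fun _ => 1) fun ω => ?_).trans (by simpa using ih)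
    exact prob_le_one

theorem measurable_snoc {Ω₁ : Type*} [MeasurableSpace Ω₁] {T : ℕ} (ω : Fin T → Ω₁) :
    Measurable (Fin.snoc (α := fun _ => Ω₁) ω) := by
  refine measurable_pi_lambda _ fun i => ?_
  induction i using Fin.lastCases with
  | last => simpa using measurable_id'
  | cast i => simp

/-- A universally measurable property that holds almost surely under each one-step measure holds
almost surely under the product measure. -/
theorem ae_prodMeas_succ {Ω₁ : Type*} [MeasurableSpace Ω₁]
    (P : (t : ℕ) → (Fin t → Ω₁) → ProbabilityMeasure Ω₁) {T : ℕ}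
    {p : (Fin (T + 1) → Ω₁) → Prop} (hp : UnivMeasurableSet {ω | p ω})
    (h : ∀ ω : Fin T → Ω₁, ∀ᵐ ω' ∂(P T ω : Measure Ω₁), p (Fin.snoc ω ω')) :
    ∀ᵐ ω ∂prodMeas (fun t ω => (P t ω : Measure Ω₁)) (T + 1), p ω := by
  have : IsFiniteMeasure (prodMeas (fun t ω => (P t ω : Measure Ω₁)) (T + 1)) :=
    ⟨(prodMeas_univ_le P (T + 1)).trans_lt ENNReal.one_lt_top⟩
  obtain ⟨N, hN, hNm, hNae⟩ :=
    (hp.nullMeasurableSet (prodMeas (fun t ω => (P t ω : Measure Ω₁)) (T + 1))).compl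
      |>.exists_measurable_subset_ae_eq
  rw [ae_iff, ← compl_ofPred, ← measure_congr hNae, ← nonpos_iff_eq_zero]
  refine (Measure.bind_apply_le _ hNm).trans ?_
  rw [nonpos_iff_eq_zero, lintegral_eq_zero_of_ae_eq_zero]
  refine ae_of_all _ fun ω => ?_
  refine nonpos_iff_eq_zero.1 (le_trans ?_ (ae_iff.1 (h ω)).le)
  change (Measure.map (Fin.snoc ω) (P T ω : Measure Ω₁)) N ≤ _
  rw [Measure.map_apply (measurable_snoc ω) hNm]
  exact measure_mono fun ω' hω' => hN hω'

/-- Lemma 5.11. Every `𝓕ₜ`-measurable `f` valued `𝒫`-q.s. in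
`Kₜ + Λₜ` decomposes `𝒫`-q.s. as `f = g + h` with `g ∈ L⁰(Kₜ; 𝓕ₜ)` and
`h ∈ L⁰(K̃ₜ₊₁; 𝓕ₜ)`. -/
theorem decomposition_lemma {Ω₁ : Type*} [TopologicalSpace Ω₁] [PolishSpace Ω₁]
    [MeasurableSpace Ω₁] [BorelSpace Ω₁] (t d : ℕ)
    (𝒬 : (s : ℕ) → (Fin s → Ω₁) → Set (ProbabilityMeasure Ω₁))
    (h𝒬ne : ∀ s, s ≤ t → ∀ ω, (𝒬 s ω).Nonempty)
    (h𝒬conv : ∀ s, s ≤ t → ∀ ω, ConvexProb (𝒬 s ω))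
    (h𝒬graph : ∀ s, s ≤ t →
      AnalyticSet {p : (Fin s → Ω₁) × ProbabilityMeasure Ω₁ | p.2 ∈ 𝒬 s p.1})
    (K : (Fin t → Ω₁) → Set (Fin d → ℝ))
    (hKcl : ∀ ω, IsClosed (K ω)) (hKconv : ∀ ω, Convex ℝ (K ω))
    (hKcone : ∀ ω, ∀ c : ℝ, 0 ≤ c → ∀ x ∈ K ω, c • x ∈ K ω)
    (hKorth : ∀ ω, {x : Fin d → ℝ | ∀ i, 0 ≤ x i} ⊆ K ω)
    (hKgraph : AnalyticSet {p : (Fin t → Ω₁) × (Fin d → ℝ) | p.2 ∈ dualCone (K p.1)})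
    (Kt1star : (Fin (t + 1) → Ω₁) → Set (Fin d → ℝ))
    (hne : ∀ ω, (Kt1star ω).Nonempty) (hcl : ∀ ω, IsClosed (Kt1star ω))
    (hconv : ∀ ω, Convex ℝ (Kt1star ω))
    (hcone : ∀ ω, ∀ c : ℝ, 0 ≤ c → ∀ x ∈ Kt1star ω, c • x ∈ Kt1star ω)
    (hgraph : AnalyticSet {q : (Fin (t + 1) → Ω₁) × (Fin d → ℝ) | q.2 ∈ Kt1star q.1})
    (f : (Fin t → Ω₁) → Fin d → ℝ) (hf : UnivMeasurable f)
    (hfqs : ∀ μ ∈ ProdSet 𝒬 t, ∀ᵐ ω ∂μ, f ω ∈ K ω + LambdaSet (𝒬 t) Kt1star ω) :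
    ∃ g h : (Fin t → Ω₁) → Fin d → ℝ,
      UnivMeasurable g ∧ UnivMeasurable h ∧
      (∀ ω, g ω ∈ K ω) ∧
      (∀ μ ∈ ProdSet 𝒬 (t + 1), ∀ᵐ ωbar ∂μ, h (Fin.init ωbar) ∈ dualCone (Kt1star ωbar)) ∧
      (∀ μ ∈ ProdSet 𝒬 t, ∀ᵐ ω ∂μ, f ω = g ω + h ω) := by
  let φ : (Fin t → Ω₁) → (Fin d → ℝ) → ℝ := fun ω x => coneGap (dualCone (K ω)) x
  let ψ : (Fin t → Ω₁) → (Fin d → ℝ) → ℝ := fun ω x =>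
    qsSup (𝒬 t ω) fun ω' => coneGap (Kt1star (Fin.snoc ω ω')) x
  have hK0 : ∀ ω, (0 : Fin d → ℝ) ∈ K ω := fun ω => hKorth ω fun i => le_rfl
  have hφ : ∀ ω x, φ ω x ≤ 0 ↔ x ∈ K ω := fun ω x => by
    rw [coneGap_le_zero_iff, dualCone_dualCone (hKcl ω) (hKconv ω) (hKcone ω) (hK0 ω)]
  have hψ : ∀ ω x, ψ ω x ≤ 0 ↔ x ∈ LambdaSet (𝒬 t) Kt1star ω := fun ω x => by
    rw [qsSup_le_zero_iff fun ω' => coneGap_le _ x]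
    simp only [coneGap_le_zero_iff]
    rfl
  have hψle : ∀ ω x y, ψ ω x ≤ ψ ω y + d * ‖x - y‖ := fun ω x y =>
    qsSup_le_add _ (fun _ => coneGap_le _ x) (fun _ => coneGap_le _ y) (by positivity)
      fun _ => coneGap_le_add _ x y
  have hgap : ∀ x, ∀ c, 0 ≤ c → AnalyticSet {ω | c < coneGap (Kt1star ω) x} :=
    fun x c hc => analyticSet_setOf_lt_coneGap hgraph x hc
  have hφm : ∀ x, UnivMeasurable fun ω => φ ω x := fun x =>
    univMeasurable_of_analyticSet (fun ω => coneGap_nonneg _ x) fun c hc =>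
      analyticSet_setOf_lt_coneGap hKgraph x hc
  have hψm : ∀ x, UnivMeasurable fun ω => ψ ω x := fun x =>
    univMeasurable_of_analyticSet (fun ω => qsSup_nonneg _ _) fun c hc =>
      analyticSet_setOf_lt_qsSup (h𝒬graph t le_rfl)
        (φ := fun ω ω' => coneGap (Kt1star (Fin.snoc ω ω')) x)
        (fun _ _ => coneGap_le _ x) hc
        ((hgap x c hc).preimage (f := fun p : (Fin t → Ω₁) × Ω₁ =>
          (Fin.snoc p.1 p.2 : Fin (t + 1) → Ω₁)) 
          (Continuous.finSnoc (A := fun _ => Ω₁) continuous_fst continuous_snd))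
  obtain ⟨g, h, hg, hh, hgK, hhL, hgh⟩ := @exists_measurable_decomposition _ (univComp _) d φ ψ
    (fun ω x => coneGap_nonneg _ x) (fun ω x => qsSup_nonneg _ _) hφm hψm
    (fun ω => continuous_coneGap _)
    (fun ω => continuous_of_le_add_mul_norm d.cast_nonneg (hψle ω)) K
    (LambdaSet (𝒬 t) Kt1star) hφ hψ hKconv
    (fun ω x hx y hy a b ha hb hab P hP => by
      filter_upwards [hx P hP, hy P hP] with ω' hx' hy'
      exact convex_dualCone _ hx' hy' ha hb hab)
    hK0 (fun ω P _ => ae_of_all _ fun ω' z _ => by simp) f hf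
  refine ⟨g, h, hg, hh, hgK, ?_, fun μ hμ => ?_⟩
  · rintro _ ⟨P, hP, rfl⟩
    refine ae_prodMeas_succ P ?_ fun ω => ?_
    · have hu := @measurable_uncurry_of_continuous_of_measurable (Fin (t + 1) → Ω₁) ℝ
        (Fin d → ℝ) _ _ _ _ _ _ _ _ _ (univComp _) (fun x ω => coneGap (Kt1star ω) x)
        (fun ω => continuous_coneGap _)
        (fun x => univMeasurable_of_analyticSet (fun ω => coneGap_nonneg _ x) (hgap x))
      have hinit : Measurable fun ω : Fin (t + 1) → Ω₁ => (Fin.init ω : Fin t → Ω₁) :=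
        measurable_pi_lambda _ fun i => measurable_pi_apply _
      have hhi : UnivMeasurable fun ω : Fin (t + 1) → Ω₁ => h (Fin.init ω) :=
        @Measurable.comp _ _ _ (univComp _) (univComp _) _ _ _ hh hinit.univComp
      have hset := (hu.comp (@Measurable.prodMk _ _ _ _ _ (univComp _) _ _ hhi
        (@measurable_id _ (univComp _)))) (measurableSet_Iic (a := (0 : ℝ)))
      have heq : {ω : Fin (t + 1) → Ω₁ | h (Fin.init ω) ∈ dualCone (Kt1star ω)} =
          {ω | coneGap (Kt1star ω) (h (Fin.init ω)) ≤ 0} :=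
        Set.ext fun ω => coneGap_le_zero_iff.symm
      rw [heq]
      exact hset
    · simpa using hhL ω (P t ω) ((hP t (Nat.lt_succ_self t)).2 ω)
  · filter_upwards [hfqs μ hμ] with ω hω using hgh ω hω
end
end

section
/- Let Ω be a Polish space and Φ : Ω ⇉ ℝ^d a set-valued map whose graph {(ω,y) : y ∈ Φ(ω)} is an analytic subset of Ω × ℝ^d. Then: (i) the map ω ↦ conv(Φ(ω)) (pointwise convex hull) has analytic graph; (ii) the map ω ↦ cl(Φ(ω)) (pointwise closure) has analytic graph; (iii) if Φ(ω) is convex for every ω, then the map ω ↦ int(Φ(ω)) (pointwise interior) has analytic graph; (iv) if Ψ : Ω ⇉ ℝ^d also has analytic graph, then ω ↦ Φ(ω) ∩ Ψ(ω) has analytic graph. -/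
open MeasureTheory Set

theorem MeasureTheory.AnalyticSet.inter {X : Type*} [TopologicalSpace X] [T2Space X] {s t : Set X}
    (hs : AnalyticSet s) (ht : AnalyticSet t) : AnalyticSet (s ∩ t) := by
  rw [inter_eq_iInter]
  exact AnalyticSet.iInter (by rintro (_ | _) <;> assumption)

/-- A point lies in the convex hull of `s` iff it is a convex combination of a nonempty finite
sequence of points of `s`. -/
theorem mem_convexHull_iff_exists_fin {E : Type*} [AddCommGroup E] [Module ℝ E] {s : Set E}
    {x : E} : x ∈ convexHull ℝ s ↔ ∃ (n : ℕ) (w : Fin (n + 1) → ℝ) (z : Fin (n + 1) → E),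
      w ∈ stdSimplex ℝ (Fin (n + 1)) ∧ (∀ i, z i ∈ s) ∧ ∑ i, w i • z i = x := by
  constructor
  · intro hx
    obtain ⟨ι, _, w, z, hw₀, hw₁, hz, rfl⟩ := mem_convexHull_iff_exists_fintype.1 hx
    have : Nonempty ι := by
      by_contra h
      rw [not_nonempty_iff] at h
      simp at hw₁
    obtain ⟨n, hn⟩ := Nat.exists_eq_succ_of_ne_zero (Fintype.card_ne_zero (α := ι))
    let e : Fin (n + 1) ≃ ι := (Fintype.equivFinOfCardEq hn).symm
    refine ⟨n, w ∘ e, z ∘ e, ⟨fun i ↦ hw₀ _, ?_⟩, fun i ↦ hz _, ?_⟩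
    · simpa using (e.sum_comp w).trans hw₁
    · exact e.sum_comp fun i ↦ w i • z i
  · rintro ⟨n, w, z, hw, hz, hx⟩
    exact mem_convexHull_of_exists_fintype w z hw.1 hw.2 hz hx

/-- A point is interior to a convex set `C` of `ι → ℝ` iff `C` contains the vertices of some cube
centred at that point. -/
theorem Convex.mem_interior_iff_exists_cube {ι : Type*} [Fintype ι] {C : Set (ι → ℝ)}
    (hC : Convex ℝ C) {y : ι → ℝ} :
    y ∈ interior C ↔
      ∃ n : ℕ, ∀ σ : ι → ℤˣ, (fun i ↦ y i + ((σ i : ℤ) : ℝ) * (1 / ((n : ℝ) + 1))) ∈ C := by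
  constructor
  · intro hy
    obtain ⟨r, hr, hball⟩ := Metric.mem_nhds_iff.1 (mem_interior_iff_mem_nhds.1 hy)
    obtain ⟨n, hn⟩ := exists_nat_one_div_lt hr
    have hpos : (0 : ℝ) < 1 / ((n : ℝ) + 1) := Nat.one_div_pos_of_nat
    refine ⟨n, fun σ ↦ hball ?_⟩
    rw [Metric.mem_ball, dist_pi_lt_iff hr]
    intro i
    rcases Int.units_eq_one_or (σ i) with h | h <;>
      simpa [h, Real.dist_eq, abs_of_pos (Nat.cast_add_one_pos (α := ℝ) n)] using hn
  · rintro ⟨n, hn⟩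
    set ε : ℝ := 1 / ((n : ℝ) + 1)
    have hε : 0 < ε := Nat.one_div_pos_of_nat
    rw [mem_interior_iff_mem_nhds]
    refine Filter.mem_of_superset (Metric.closedBall_mem_nhds y hε) fun x hx ↦ ?_
    rw [closedBall_pi _ hε.le] at hx
    have hvert : (univ.pi fun i ↦ {y i - ε, y i + ε}) ⊆ C := by
      intro v hv
      classical
      convert hn fun i ↦ if v i = y i + ε then 1 else -1 with i
      split_ifs with h
      · simpa using h
      · rcases hv i (mem_univ i) with h' | h'
        · simpa [sub_eq_add_neg] using h'
        · exact absurd h' h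
    refine convexHull_min hvert hC (mem_convexHull_pi fun i hi ↦ ?_)
    rw [convexHull_pair, segment_eq_Icc (by linarith), ← Real.closedBall_eq_Icc]
    exact hx i hi

section AnalyticGraph

variable {Ω E : Type*} [TopologicalSpace Ω] [PolishSpace Ω]

theorem analyticSet_graph_convexHull [AddCommGroup E] [Module ℝ E] [TopologicalSpace E]
    [PolishSpace E] [ContinuousAdd E] [ContinuousSMul ℝ E] {Φ : Ω → Set E}
    (hΦ : AnalyticSet {p : Ω × E | p.2 ∈ Φ p.1}) :
    AnalyticSet {p : Ω × E | p.2 ∈ convexHull ℝ (Φ p.1)} := by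
  have key : ∀ n : ℕ, AnalyticSet ((fun q : Ω × (Fin (n + 1) → ℝ) × (Fin (n + 1) → E) ↦
      (q.1, ∑ i, q.2.1 i • q.2.2 i)) ''
        ({q | q.2.1 ∈ stdSimplex ℝ (Fin (n + 1))} ∩
          ⋂ i, (fun q ↦ (q.1, q.2.2 i)) ⁻¹' {p : Ω × E | p.2 ∈ Φ p.1})) := by
    intro n
    refine AnalyticSet.image_of_continuous (AnalyticSet.inter ?_ ?_) (by fun_prop)
    · exact ((isClosed_stdSimplex ℝ _).preimage (by fun_prop)).analyticSet
    · exact AnalyticSet.iInter fun i ↦ hΦ.preimage (by fun_prop)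
  convert AnalyticSet.iUnion key
  ext ⟨ω, y⟩
  simp only [mem_ofPred_eq, mem_convexHull_iff_exists_fin, mem_iUnion, mem_image, mem_inter_iff,
    mem_iInter, mem_preimage, Prod.exists, Prod.mk.injEq]
  refine exists_congr fun n ↦ ⟨?_, ?_⟩
  · rintro ⟨w, z, hw, hz, hy⟩
    exact ⟨ω, w, z, ⟨hw, hz⟩, rfl, hy⟩
  · rintro ⟨_, w, z, ⟨hw, hz⟩, rfl, hy⟩
    exact ⟨w, z, hw, hz, hy⟩

theorem analyticSet_graph_closure [PseudoMetricSpace E] [PolishSpace E] {Φ : Ω → Set E}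
    (hΦ : AnalyticSet {p : Ω × E | p.2 ∈ Φ p.1}) :
    AnalyticSet {p : Ω × E | p.2 ∈ closure (Φ p.1)} := by
  have key : ∀ n : ℕ, AnalyticSet ((fun q : Ω × E × E ↦ (q.1, q.2.1)) ''
      ({q | dist q.2.1 q.2.2 ≤ 1 / ((n : ℝ) + 1)} ∩
        (fun q ↦ (q.1, q.2.2)) ⁻¹' {p : Ω × E | p.2 ∈ Φ p.1})) := by
    intro n
    refine AnalyticSet.image_of_continuous (AnalyticSet.inter ?_ ?_) (by fun_prop)
    · exact (isClosed_le (by fun_prop) (by fun_prop)).analyticSet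
    · exact hΦ.preimage (by fun_prop)
  convert AnalyticSet.iInter key
  ext ⟨ω, y⟩
  simp only [mem_ofPred_eq, Metric.mem_closure_iff, mem_image, mem_inter_iff,
    mem_iInter, mem_preimage, Prod.exists, Prod.mk.injEq]
  constructor
  · intro h n
    obtain ⟨z, hz, hyz⟩ := h _ (Nat.one_div_pos_of_nat (n := n))
    exact ⟨ω, y, z, ⟨hyz.le, hz⟩, rfl, rfl⟩
  · intro h ε hε
    obtain ⟨n, hn⟩ := exists_nat_one_div_lt hε
    obtain ⟨_, _, z, ⟨hyz, hz⟩, rfl, rfl⟩ := h n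
    exact ⟨z, hz, hyz.trans_lt hn⟩

theorem analyticSet_graph_interior_of_convex {ι : Type*} [Fintype ι] {Φ : Ω → Set (ι → ℝ)}
    (hΦ : AnalyticSet {p : Ω × (ι → ℝ) | p.2 ∈ Φ p.1}) (hconv : ∀ ω, Convex ℝ (Φ ω)) :
    AnalyticSet {p : Ω × (ι → ℝ) | p.2 ∈ interior (Φ p.1)} := by
  simp only [(hconv _).mem_interior_iff_exists_cube, ofPred_exists, ofPred_forall]
  exact AnalyticSet.iUnion fun n ↦ AnalyticSet.iInter fun σ ↦
    hΦ.preimage (f := fun p : Ω × (ι → ℝ) ↦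
      (p.1, fun i ↦ p.2 i + ((σ i : ℤ) : ℝ) * (1 / ((n : ℝ) + 1))))
      (by fun_prop)

end AnalyticGraph

/-- Operations preserving analyticity of the graph of a set-valued map
`Φ : Ω ⇉ ℝ^d`: convex hull, closure, interior (for convex values) and intersection. -/
theorem analyticGraph_operations {Ω : Type*} [TopologicalSpace Ω] [PolishSpace Ω] {d : ℕ}
    (Φ Ψ : Ω → Set (Fin d → ℝ))
    (hΦ : AnalyticSet {p : Ω × (Fin d → ℝ) | p.2 ∈ Φ p.1})
    (hΨ : AnalyticSet {p : Ω × (Fin d → ℝ) | p.2 ∈ Ψ p.1}) :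
    AnalyticSet {p : Ω × (Fin d → ℝ) | p.2 ∈ convexHull ℝ (Φ p.1)} ∧
    AnalyticSet {p : Ω × (Fin d → ℝ) | p.2 ∈ closure (Φ p.1)} ∧
    ((∀ ω, Convex ℝ (Φ ω)) →
      AnalyticSet {p : Ω × (Fin d → ℝ) | p.2 ∈ interior (Φ p.1)}) ∧
    AnalyticSet {p : Ω × (Fin d → ℝ) | p.2 ∈ Φ p.1 ∩ Ψ p.1} :=
  ⟨analyticSet_graph_convexHull hΦ, analyticSet_graph_closure hΦ,
    analyticSet_graph_interior_of_convex hΦ, hΦ.inter hΨ⟩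
end
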